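/- Let m be a positive integer, let α = (α₁, …, α_m) be an m-tuple of real numbers, and let n be a positive integer. For integers 1 ≤ j < k ≤ n define d(j,k) = √(Σ_{i=1}^m ‖(k−j)αᵢ‖²). For 1 ≤ r ≤ m let I^r_{j,k} ⊆ [0,1) be the geodesic joining {jα_r} and {kα_r}: writing m' = min({jα_r},{kα_r}) and M = max({jα_r},{kα_r}), set I^r_{j,k} = [m', M) if M − m' ≤ 1/2 and I^r_{j,k} = [0, m') ∪ [M, 1) otherwise. Define S(n) = { d(j,k) : 1 ≤ j < k ≤ n, and for all 1 ≤ p < q ≤ n, d(p,q) < d(j,k) implies I^r_{p,q} ∩ I^r_{j,k} = ∅ for every 1 ≤ r ≤ m }. Then |S(n)| ≤ ⌈√m⌉^m · (⌈√m⌉^m + 2^m + 1) + 2. -/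

import Mathlib

/-- `nint x` is the distance from the real number `x` to the nearest integer. -/
noncomputable def nint (x : ℝ) : ℝ := |x - round x|

/-- The "geodesic" on the circle `[0,1)` joining two points `a, b ∈ [0,1)`. -/
noncomputable def geodesic (a b : ℝ) : Set ℝ :=
  if max a b - min a b ≤ 1 / 2 then Set.Ico (min a b) (max a b)
  else Set.Ico 0 (min a b) ∪ Set.Ico (max a b) 1

/-- `lenm α q = √(Σᵢ ‖qαᵢ‖²)`, the length of the integer `q` w.r.t. `α : Fin m → ℝ`. -/
noncomputable def lenm {m : ℕ} (α : Fin m → ℝ) (q : ℕ) : ℝ :=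
  Real.sqrt (∑ i, nint ((q : ℝ) * α i) ^ 2)

/-- The shorter arc between `a, b ∈ [0,1)` runs upwards from `a` to `b`. -/
def Ascends (a b : ℝ) : Prop := (a < b ∧ b - a ≤ 1 / 2) ∨ (b < a ∧ 1 / 2 < a - b)

lemma ascends_or_ascends {a b : ℝ} (h : a ≠ b) : Ascends a b ∨ Ascends b a := by
  unfold Ascends
  rcases lt_or_gt_of_ne h with h | h <;> rcases le_or_gt |a - b| (1 / 2) with h' | h'
  · rw [abs_sub_comm, abs_of_pos (by linarith)] at h'; tauto
  · rw [abs_sub_comm, abs_of_pos (by linarith)] at h'; tauto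
  · rw [abs_of_pos (by linarith)] at h'; tauto
  · rw [abs_of_pos (by linarith)] at h'; tauto

lemma Ascends.not_ascends {a b : ℝ} (h : Ascends a b) : ¬ Ascends b a := by
  rintro (⟨h1, h2⟩ | ⟨h1, h2⟩) <;> rcases h with ⟨h3, h4⟩ | ⟨h3, h4⟩ <;> linarith

lemma geodesic_comm (a b : ℝ) : geodesic a b = geodesic b a := by
  unfold geodesic
  rw [max_comm, min_comm]

lemma geodesic_of_lt {a b : ℝ} (h : a < b) (h' : b - a ≤ 1 / 2) :
    geodesic a b = Set.Ico a b := by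
  unfold geodesic
  rw [max_eq_right h.le, min_eq_left h.le, if_pos h']

lemma geodesic_of_gt {a b : ℝ} (h : b < a) (h' : 1 / 2 < a - b) :
    geodesic a b = Set.Ico 0 b ∪ Set.Ico a 1 := by
  unfold geodesic
  rw [max_eq_left h.le, min_eq_right h.le, if_neg (not_le.2 h')]

lemma Ascends.left_mem {a b : ℝ} (h : Ascends a b) (ha : a < 1) : a ∈ geodesic a b := by
  rcases h with ⟨h, h'⟩ | ⟨h, h'⟩
  · rw [geodesic_of_lt h h']; exact ⟨le_rfl, h⟩
  · rw [geodesic_of_gt h h']; exact Or.inr ⟨le_rfl, ha⟩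

/-- Two arcs ascending from a common starting point meet. -/
lemma Ascends.inter_of_left {a b c : ℝ} (h : Ascends a b) (h' : Ascends a c) (ha : a < 1) :
    geodesic a b ∩ geodesic a c ≠ ∅ :=
  Set.Nonempty.ne_empty ⟨a, h.left_mem ha, h'.left_mem ha⟩

/-- Two arcs ascending to a common end point meet. -/
lemma Ascends.inter_of_right {a b c : ℝ} (h : Ascends a c) (h' : Ascends b c)
    (ha : a ∈ Set.Ico (0 : ℝ) 1) (hb : b ∈ Set.Ico (0 : ℝ) 1) :
    geodesic a c ∩ geodesic b c ≠ ∅ := by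
  apply Set.Nonempty.ne_empty
  rcases h with ⟨h, h1⟩ | ⟨h, h1⟩ <;> rcases h' with ⟨h', h2⟩ | ⟨h', h2⟩
  · rw [geodesic_of_lt h h1, geodesic_of_lt h' h2]
    exact ⟨max a b, ⟨le_max_left _ _, max_lt h h'⟩, ⟨le_max_right _ _, max_lt h h'⟩⟩
  · rw [geodesic_of_lt h h1, geodesic_of_gt h' h2]
    exact ⟨a, ⟨le_rfl, h⟩, Or.inl ⟨ha.1, h⟩⟩
  · rw [geodesic_of_gt h h1, geodesic_of_lt h' h2]
    exact ⟨b, Or.inl ⟨hb.1, h'⟩, ⟨le_rfl, h'⟩⟩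
  · rw [geodesic_of_gt h h1, geodesic_of_gt h' h2]
    exact ⟨max a b, Or.inr ⟨le_max_left _ _, max_lt ha.2 hb.2⟩,
      Or.inr ⟨le_max_right _ _, max_lt ha.2 hb.2⟩⟩

lemma nint_eq_min (x : ℝ) : nint x = min (Int.fract x) (1 - Int.fract x) :=
  abs_sub_round_eq_min x

lemma nint_nonneg (x : ℝ) : 0 ≤ nint x := abs_nonneg _

lemma nint_le_half (x : ℝ) : nint x ≤ 1 / 2 := abs_sub_round x

lemma nint_eq_zero_iff (x : ℝ) : nint x = 0 ↔ Int.fract x = 0 := by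
  rw [nint_eq_min]
  have h0 := Int.fract_nonneg x
  have h1 := Int.fract_lt_one x
  constructor
  · intro h
    rcases min_choice (Int.fract x) (1 - Int.fract x) with h' | h' <;> linarith
  · intro h
    rw [h]; norm_num

lemma nint_of_fract_le {x : ℝ} (h : Int.fract x ≤ 1 / 2) : nint x = Int.fract x := by
  rw [nint_eq_min, min_eq_left (by linarith)]

lemma nint_of_le_fract {x : ℝ} (h : 1 / 2 ≤ Int.fract x) : nint x = 1 - Int.fract x := by
  rw [nint_eq_min, min_eq_right (by linarith)]

lemma fract_add_cases (x y : ℝ) : Int.fract (x + y) = Int.fract x + Int.fract y ∨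
    Int.fract (x + y) = Int.fract x + Int.fract y - 1 := by
  rcases lt_or_ge (Int.fract x + Int.fract y) 1 with h | h
  · left
    rw [Int.fract_eq_iff]
    refine ⟨add_nonneg (Int.fract_nonneg _) (Int.fract_nonneg _), h, ⌊x⌋ + ⌊y⌋, ?_⟩
    rw [Int.fract, Int.fract]; push_cast; ring
  · right
    have hx := Int.fract_lt_one x
    have hy := Int.fract_lt_one y
    rw [Int.fract_eq_iff]
    refine ⟨by linarith, by linarith, ⌊x⌋ + ⌊y⌋ + 1, ?_⟩
    rw [Int.fract, Int.fract]; push_cast; ring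

lemma ascends_fract_add {x y : ℝ} (h0 : 0 < Int.fract y) (h : Int.fract y < 1 / 2) :
    Ascends (Int.fract x) (Int.fract (x + y)) := by
  rcases fract_add_cases x y with e | e <;> rw [e]
  · left; constructor <;> linarith
  · right; constructor <;> linarith

lemma fract_add_ascends {x y : ℝ} (h : 1 / 2 < Int.fract y) :
    Ascends (Int.fract (x + y)) (Int.fract x) := by
  have := Int.fract_lt_one y
  rcases fract_add_cases x y with e | e <;> rw [e]
  · right; constructor <;> linarith
  · left; constructor <;> linarith

lemma fract_ne_fract_add {x y : ℝ} (h : Int.fract y ≠ 0) :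
    Int.fract x ≠ Int.fract (x + y) := by
  have := Int.fract_lt_one y
  intro e'
  rcases fract_add_cases x y with e | e
  · apply h; linarith
  · linarith

lemma fract_sub_of_pos {x y : ℝ} (h : 0 ≤ Int.fract x - Int.fract y) :
    Int.fract (x - y) = Int.fract x - Int.fract y := by
  rw [Int.fract_eq_iff]
  refine ⟨h, by linarith [Int.fract_lt_one x, Int.fract_nonneg y], ⌊x⌋ - ⌊y⌋, ?_⟩
  rw [Int.fract, Int.fract]; push_cast; ring

lemma fract_sub_of_neg {x y : ℝ} (h : Int.fract x - Int.fract y < 0) :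
    Int.fract (x - y) = 1 + (Int.fract x - Int.fract y) := by
  rw [Int.fract_eq_iff]
  refine ⟨by linarith [Int.fract_lt_one y, Int.fract_nonneg x], by linarith, ⌊x⌋ - ⌊y⌋ - 1, ?_⟩
  rw [Int.fract, Int.fract]; push_cast; ring

lemma nint_sub {x y : ℝ} (h : |Int.fract x - Int.fract y| < 1 / 2) :
    nint (x - y) = |Int.fract x - Int.fract y| := by
  rcases lt_or_ge (Int.fract x - Int.fract y) 0 with h' | h'
  · have e := fract_sub_of_neg h'
    rw [abs_of_neg h'] at h ⊢
    rw [nint_of_le_fract (by linarith), e]; ring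
  · have e := fract_sub_of_pos h'
    rw [abs_of_nonneg h'] at h ⊢
    rw [nint_of_fract_le (by linarith), e]

/-- The difference `q` occurs between two indices in `[1, n]` forming a pair which no strictly
shorter pair overlaps. -/
def IsWinner {m : ℕ} (α : Fin m → ℝ) (n q : ℕ) : Prop :=
  ∃ j k : ℕ, 1 ≤ j ∧ j < k ∧ k ≤ n ∧ q = k - j ∧
    ∀ p q : ℕ, 1 ≤ p → p < q → q ≤ n → lenm α (q - p) < lenm α (k - j) →
      ∀ r : Fin m,
        geodesic (Int.fract ((p : ℝ) * α r)) (Int.fract ((q : ℝ) * α r)) ∩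
          geodesic (Int.fract ((j : ℝ) * α r)) (Int.fract ((k : ℝ) * α r)) = ∅

/-- A step `s` of length less than `1 / 2` going up (if `U`) or down (if `D`), all of whose arcs
avoid the arc from `x j` to `x k`, points away from that arc whenever it can be attached inside. -/
lemma opposite_of_disjoint {x : ℕ → ℝ} (hI : ∀ p, x p ∈ Set.Ico (0 : ℝ) 1) {U D : Prop}
    {s n j k : ℕ} (hj : 1 ≤ j) (hk : k ≤ n) (hjs : j + s ≤ n ∨ s + 1 ≤ k)
    (pos : ∀ p, U → Ascends (x p) (x (p + s))) (neg : ∀ p, D → Ascends (x (p + s)) (x p))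
    (dis : ∀ p, 1 ≤ p → p + s ≤ n →
      geodesic (x p) (x (p + s)) ∩ geodesic (x j) (x k) = ∅) :
    (Ascends (x j) (x k) → ¬ U) ∧ (Ascends (x k) (x j) → ¬ D) := by
  rcases hjs with h | h
  · have d := dis j hj h
    refine ⟨fun hu hp => (pos j hp).inter_of_left hu (hI _).2 d, fun hu hp => ?_⟩
    refine (neg j hp).inter_of_right hu (hI _) (hI _) ?_
    rwa [geodesic_comm, geodesic_comm (x k) (x j)]
  · have d := dis (k - s) (by omega) (by omega)
    have p' := pos (k - s)
    have n' := neg (k - s)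
    rw [Nat.sub_add_cancel (by omega)] at d p' n'
    refine ⟨fun hu hp => (p' hp).inter_of_right hu (hI _) (hI _) d, fun hu hp => ?_⟩
    refine (n' hp).inter_of_left hu (hI _).2 ?_
    rwa [geodesic_comm, geodesic_comm (x k) (x j)]

/-- A step as in `opposite_of_disjoint` points along the arc from `x j` to `x k` whenever it can
be attached outside. -/
lemma parallel_of_disjoint {x : ℕ → ℝ} (hI : ∀ p, x p ∈ Set.Ico (0 : ℝ) 1) {U D : Prop}
    {s n j k : ℕ} (hj : j ≤ n) (hk : 1 ≤ k) (hjs : s + 1 ≤ j ∨ k + s ≤ n)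
    (pos : ∀ p, U → Ascends (x p) (x (p + s))) (neg : ∀ p, D → Ascends (x (p + s)) (x p))
    (dis : ∀ p, 1 ≤ p → p + s ≤ n →
      geodesic (x p) (x (p + s)) ∩ geodesic (x j) (x k) = ∅) :
    (Ascends (x j) (x k) → ¬ D) ∧ (Ascends (x k) (x j) → ¬ U) := by
  have := opposite_of_disjoint hI (j := k) (k := j) hk hj hjs.symm pos neg
    (fun p h h' => by rw [geodesic_comm (x k)]; exact dis p h h')
  exact ⟨this.2, this.1⟩

/-- Every strictly shorter difference `s` below `M + q` points away from a winner `q`, and none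
lies below `M`. Here `σ r` records whether the arc of the winner goes up in coordinate `r`. -/
lemma IsWinner.exists_barrier {m n q : ℕ} {α : Fin m → ℝ} (h : IsWinner α n q) :
    ∃ (M : ℕ) (σ : Fin m → Prop), n + 1 ≤ 2 * M + q ∧
      (∀ r, (0 < Int.fract (q * α r) → Int.fract (q * α r) < 1 / 2 → σ r) ∧
        (1 / 2 < Int.fract (q * α r) → ¬ σ r)) ∧
      ∀ s, 1 ≤ s → s < n → lenm α s < lenm α q → ∀ r, Int.fract (q * α r) ≠ 0 →
        (s < M + q → (σ r → ¬ (0 < Int.fract (s * α r) ∧ Int.fract (s * α r) < 1 / 2)) ∧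
          (¬ σ r → ¬ 1 / 2 < Int.fract (s * α r))) ∧
        (s < M → Int.fract (s * α r) = 0 ∨ Int.fract (s * α r) = 1 / 2) := by
  obtain ⟨j, k, hj, hjk, hk, rfl, hw⟩ := h
  refine ⟨max j (n - k + 1),
    fun r => Ascends (Int.fract ((j : ℝ) * α r)) (Int.fract ((k : ℝ) * α r)), by omega, fun r => ?_, ?_⟩
  · have e : (k : ℝ) * α r = (j : ℝ) * α r + ((k - j : ℕ) : ℝ) * α r := by
      rw [← add_mul, ← Nat.cast_add, Nat.add_sub_cancel' hjk.le]
    beta_reduce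
    rw [e]
    exact ⟨ascends_fract_add, fun h => (fract_add_ascends h).not_ascends⟩
  intro s hs hsn hlt r hr
  obtain ⟨x, hx⟩ : ∃ x : ℕ → ℝ, ∀ p : ℕ, Int.fract ((p : ℝ) * α r) = x p := ⟨_, fun _ => rfl⟩
  have hI : ∀ p, x p ∈ Set.Ico (0 : ℝ) 1 :=
    fun p => hx p ▸ ⟨Int.fract_nonneg _, Int.fract_lt_one _⟩
  have hkj : Ascends (x j) (x k) ∨ Ascends (x k) (x j) := by
    apply ascends_or_ascends
    have := fract_ne_fract_add (x := (j : ℝ) * α r) hr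
    rwa [← add_mul, ← Nat.cast_add, Nat.add_sub_cancel' hjk.le, hx, hx] at this
  have pos : ∀ p : ℕ, (0 < x s ∧ x s < 1 / 2) → Ascends (x p) (x (p + s)) := by
    intro p h
    rw [← hx s] at h
    have := ascends_fract_add (x := (p : ℝ) * α r) h.1 h.2
    rwa [← add_mul, ← Nat.cast_add, hx, hx] at this
  have neg : ∀ p : ℕ, 1 / 2 < x s → Ascends (x (p + s)) (x p) := by
    intro p h
    rw [← hx s] at h
    have := fract_add_ascends (x := (p : ℝ) * α r) h
    rwa [← add_mul, ← Nat.cast_add, hx, hx] at this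
  have dis : ∀ p : ℕ, 1 ≤ p → p + s ≤ n →
      geodesic (x p) (x (p + s)) ∩ geodesic (x j) (x k) = ∅ := by
    intro p hp hps
    have := hw p (p + s) hp (by omega) hps (by rwa [Nat.add_sub_cancel_left]) r
    rwa [hx, hx, hx, hx] at this
  simp only [hx]
  have away : s < max j (n - k + 1) + (k - j) →
      (Ascends (x j) (x k) → ¬ (0 < x s ∧ x s < 1 / 2)) ∧
        (¬ Ascends (x j) (x k) → ¬ 1 / 2 < x s) := fun hsM =>
    have h := opposite_of_disjoint hI hj hk (by omega) pos neg dis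
    ⟨h.1, fun hu => h.2 (hkj.resolve_left hu)⟩
  refine ⟨away, fun hsM => ?_⟩
  have h1 := opposite_of_disjoint hI hj hk (by omega) pos neg dis
  have h2 := parallel_of_disjoint hI (by omega) (by omega) (by omega) pos neg dis
  by_contra! hc
  rcases lt_trichotomy (x s) (1 / 2) with h | h | h
  · have hp : 0 < x s ∧ x s < 1 / 2 := ⟨lt_of_le_of_ne (hI s).1 (Ne.symm hc.1), h⟩
    exact hkj.elim (fun hu => h1.1 hu hp) fun hu => h2.2 hu hp
  · exact hc.2 h
  · exact hkj.elim (fun hu => h2.1 hu h) fun hu => h1.2 hu h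


/-- The coordinates in which `q • α` is not an integer. -/
noncomputable def fractSupport {m : ℕ} (α : Fin m → ℝ) (q : ℕ) : Finset (Fin m) :=
  Finset.univ.filter fun r => Int.fract (q * α r) ≠ 0

lemma mem_fractSupport {m : ℕ} {α : Fin m → ℝ} {q : ℕ} {r : Fin m} :
    r ∈ fractSupport α q ↔ Int.fract (q * α r) ≠ 0 := by
  simp [fractSupport]

lemma lenm_nonneg {m : ℕ} (α : Fin m → ℝ) (q : ℕ) : 0 ≤ lenm α q := Real.sqrt_nonneg _

lemma lenm_sq {m : ℕ} {α : Fin m → ℝ} {q : ℕ} {R : Finset (Fin m)}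
    (hR : ∀ r ∉ R, Int.fract (q * α r) = 0) :
    lenm α q ^ 2 = ∑ r : R, nint (q * α r) ^ 2 := by
  unfold lenm
  rw [Real.sq_sqrt (Finset.sum_nonneg fun i _ => sq_nonneg _),
    Finset.sum_coe_sort R fun r => nint (q * α r) ^ 2]
  symm
  apply Finset.sum_subset (Finset.subset_univ _)
  intro r _ hr
  rw [(nint_eq_zero_iff _).2 (hR r hr)]
  norm_num

/-- The points `x` and `y` lie in a common closed half `[0, 1/2]` or `[1/2, 1]` of the circle,
away from `0`, or both at `0`. -/
def SameSide (x y : ℝ) : Prop :=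
  (Int.fract x = 0 ∧ Int.fract y = 0) ∨
  (0 < Int.fract x ∧ 0 < Int.fract y ∧ Int.fract x ≤ 1 / 2 ∧ Int.fract y ≤ 1 / 2) ∨
  (1 / 2 ≤ Int.fract x ∧ 1 / 2 ≤ Int.fract y)

lemma SameSide.abs_fract_sub_lt {x y : ℝ} (h : SameSide x y) :
    |Int.fract x - Int.fract y| < 1 / 2 := by
  have := Int.fract_lt_one x
  have := Int.fract_lt_one y
  rw [abs_lt]
  rcases h with h | h | h <;> constructor <;> linarith

lemma SameSide.nint_sub {x y : ℝ} (h : SameSide x y) : nint (x - y) = |nint x - nint y| := by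
  rw [_root_.nint_sub h.abs_fract_sub_lt]
  rcases h with h | h | h
  · rw [nint_of_fract_le (by linarith), nint_of_fract_le (by linarith)]
  · rw [nint_of_fract_le (by linarith), nint_of_fract_le (by linarith)]
  · rw [nint_of_le_fract h.1, nint_of_le_fract h.2, abs_sub_comm]
    congr 1; ring

/-- `cell` partitions the vectors of norm less than `L` in the closed positive orthant into pieces
any two points of which are at distance less than `L`. -/
def IsCellMap {ι β : Type*} [Fintype ι] (L : ℝ) (cell : (ι → ℝ) → β) : Prop :=
  ∀ v w : ι → ℝ, (∀ i, 0 ≤ v i) → (∀ i, 0 ≤ w i) → ∑ i, v i ^ 2 < L ^ 2 → ∑ i, w i ^ 2 < L ^ 2 →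
    cell v = cell w → ∑ i, (v i - w i) ^ 2 < L ^ 2

/-- The differences of winners in a common cell are shorter than the longest winner. -/
lemma lenm_sub_lt {m : ℕ} {α : Fin m → ℝ} {L : ℝ} {R : Finset (Fin m)} {β : Type*}
    {cell : (R → ℝ) → β} (hcell : IsCellMap L cell) (hL : 0 ≤ L) {s t : ℕ} (hts : t ≤ s)
    (hs : fractSupport α s = R) (ht : fractSupport α t = R)
    (hsL : lenm α s < L) (htL : lenm α t < L)
    (hside : ∀ r, SameSide (s * α r) (t * α r))
    (hst : cell (fun r => nint (s * α r)) = cell (fun r => nint (t * α r))) :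
    lenm α (s - t) < L := by
  have off : ∀ q, fractSupport α q = R → ∀ r ∉ R, Int.fract (q * α r) = 0 := by
    rintro q rfl r hr
    rwa [mem_fractSupport, not_not] at hr
  have e : ∀ r, nint (((s - t : ℕ) : ℝ) * α r) = |nint (s * α r) - nint (t * α r)| := by
    intro r
    rw [Nat.cast_sub hts, sub_mul, (hside r).nint_sub]
  refine lt_of_pow_lt_pow_left₀ 2 hL ?_
  rw [lenm_sq (R := R)]
  · simp only [e, sq_abs]
    apply hcell _ _ (fun _ => nint_nonneg _) (fun _ => nint_nonneg _) _ _ hst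
    · rw [← lenm_sq (off s hs)]
      exact pow_lt_pow_left₀ hsL (lenm_nonneg _ _) two_ne_zero
    · rw [← lenm_sq (off t ht)]
      exact pow_lt_pow_left₀ htL (lenm_nonneg _ _) two_ne_zero
  · intro r hr
    rw [← nint_eq_zero_iff, e, (nint_eq_zero_iff _).2 (off s hs r hr),
      (nint_eq_zero_iff _).2 (off t ht r hr)]
    norm_num

/-- Winners of distinct lengths with a common support `R`: the longest one, two families occupying
distinct cells of one orthant each, and one family occupying distinct cells of all orthants. -/
lemma card_winners_le {m n : ℕ} {α : Fin m → ℝ} {R : Finset (Fin m)} {β : Type*} [Fintype β]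
    (hβ : ∀ L > 0, ∃ cell : (R → ℝ) → β, IsCellMap L cell) (Q : Finset ℕ)
    (hQ : ∀ q ∈ Q, 1 ≤ q ∧ q < n ∧ IsWinner α n q ∧ fractSupport α q = R)
    (hinj : Set.InjOn (lenm α) Q) :
    Q.card ≤ Fintype.card β * (2 ^ R.card + 2) + 1 := by
  classical
  rcases Q.eq_empty_or_nonempty with rfl | hne
  · simp
  obtain ⟨q, hq, hmax⟩ := Q.exists_max_image (lenm α) hne
  rcases (Q.erase q).eq_empty_or_nonempty with h0 | ⟨s₀, hs₀⟩
  · have := Finset.card_erase_of_mem hq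
    rw [h0, Finset.card_empty] at this
    omega
  have hlt : ∀ s ∈ Q.erase q, lenm α s < lenm α q := by
    intro s hs
    rw [Finset.mem_erase] at hs
    exact lt_of_le_of_ne (hmax s hs.2) fun h => hs.1 (hinj hs.2 hq h)
  have hL : 0 < lenm α q := (lenm_nonneg α s₀).trans_lt (hlt s₀ hs₀)
  obtain ⟨cell, hcell⟩ := hβ _ hL
  obtain ⟨-, hqn, hqw, hqR⟩ := hQ q hq
  obtain ⟨M, σ, hM, -, hbar⟩ := hqw.exists_barrier
  have memR : ∀ {s r}, s ∈ Q → (r ∈ R ↔ Int.fract (s * α r) ≠ 0) := by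
    intro s r hs
    rw [← (hQ s hs).2.2.2, mem_fractSupport]
  have side : ∀ s ∈ Q.erase q, s < M + q → ∀ r ∈ R,
      (σ r → 1 / 2 ≤ Int.fract (s * α r)) ∧ (¬ σ r → Int.fract (s * α r) ≤ 1 / 2) := by
    intro s hs hsM r hr
    have hsQ := Finset.mem_of_mem_erase hs
    have h := (hbar s (hQ s hsQ).1 (hQ s hsQ).2.1 (hlt s hs) r ((memR hq).1 hr)).1 hsM
    have h0 : 0 < Int.fract (s * α r) :=
      lt_of_le_of_ne (Int.fract_nonneg _) (Ne.symm ((memR hsQ).1 hr))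
    exact ⟨fun hu => not_lt.1 fun h' => h.1 hu ⟨h0, h'⟩, fun hu => not_lt.1 (h.2 hu)⟩
  have sameSide : ∀ s ∈ Q.erase q, ∀ t ∈ Q.erase q,
      (∀ r ∈ R, (1 / 2 ≤ Int.fract (s * α r) ∧ 1 / 2 ≤ Int.fract (t * α r)) ∨
        (Int.fract (s * α r) ≤ 1 / 2 ∧ Int.fract (t * α r) ≤ 1 / 2)) →
      ∀ r, SameSide (s * α r) (t * α r) := by
    intro s hs t ht h r
    have hsQ := Finset.mem_of_mem_erase hs
    have htQ := Finset.mem_of_mem_erase ht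
    by_cases hr : r ∈ R
    · have hs0 := lt_of_le_of_ne (Int.fract_nonneg _) (Ne.symm ((memR hsQ).1 hr))
      have ht0 := lt_of_le_of_ne (Int.fract_nonneg _) (Ne.symm ((memR htQ).1 hr))
      rcases h r hr with h | h
      · exact Or.inr (Or.inr h)
      · exact Or.inr (Or.inl ⟨hs0, ht0, h⟩)
    · exact Or.inl ⟨not_not.1 fun h => hr ((memR hsQ).2 h), not_not.1 fun h => hr ((memR htQ).2 h)⟩
  have sideAB : ∀ s ∈ Q.erase q, ∀ t ∈ Q.erase q, s < M + q → t < M + q →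
      ∀ r, SameSide (s * α r) (t * α r) := by
    intro s hs t ht hsM htM
    refine sameSide s hs t ht fun r hr => ?_
    by_cases hσ : σ r
    · exact Or.inl ⟨(side s hs hsM r hr).1 hσ, (side t ht htM r hr).1 hσ⟩
    · exact Or.inr ⟨(side s hs hsM r hr).2 hσ, (side t ht htM r hr).2 hσ⟩
  have far : ∀ s ∈ Q.erase q, ∀ t ∈ Q.erase q, t < s → (∀ r, SameSide (s * α r) (t * α r)) →
      cell (fun r => nint (s * α r)) = cell (fun r => nint (t * α r)) → M ≤ s - t := by
    intro s hs t ht hts hside hst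
    have hsQ := Finset.mem_of_mem_erase hs
    have htQ := Finset.mem_of_mem_erase ht
    have hlen := lenm_sub_lt hcell hL.le hts.le (hQ s hsQ).2.2.2 (hQ t htQ).2.2.2
      (hlt s hs) (hlt t ht) hside hst
    by_contra! hlow
    have hsn := (hQ s hsQ).2.1
    apply hts.ne
    refine hinj htQ hsQ ?_
    unfold lenm
    congr 1
    refine Finset.sum_congr rfl fun r _ => ?_
    have e := (hside r).nint_sub
    by_cases hr : r ∈ R
    · have hb := (hbar (s - t) (by omega) (by omega) hlen r ((memR hq).1 hr)).2 hlow
      have hl := (hside r).abs_fract_sub_lt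
      rw [← nint_sub hl] at hl
      rw [Nat.cast_sub hts.le, sub_mul] at hb
      rcases hb with hb | hb
      · rw [(nint_eq_zero_iff _).2 hb] at e
        rw [sub_eq_zero.1 (abs_eq_zero.1 e.symm)]
      · rw [nint_of_fract_le hb.le, hb] at hl
        exact absurd hl (lt_irrefl _)
    · rw [(nint_eq_zero_iff _).2 (not_not.1 fun h => hr ((memR hsQ).2 h)),
        (nint_eq_zero_iff _).2 (not_not.1 fun h => hr ((memR htQ).2 h))]
  have below : ∀ s ∈ Q.erase q, ∀ t ∈ Q.erase q, t < s → s < q →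
      cell (fun r => nint (s * α r)) ≠ cell (fun r => nint (t * α r)) := by
    intro s hs t ht hts hsq hst
    have hsQ := Finset.mem_of_mem_erase hs
    have htQ := Finset.mem_of_mem_erase ht
    have hside := sideAB s hs t ht (by omega) (by omega)
    have hlen := lenm_sub_lt hcell hL.le hts.le (hQ s hsQ).2.2.2 (hQ t htQ).2.2.2
      (hlt s hs) (hlt t ht) hside hst
    have hle : ∀ r ∈ R, nint (t * α r) ≤ nint (s * α r) := by
      intro r hr
      by_contra! hc
      have hb := (hbar (s - t) (by omega) (by omega) hlen r ((memR hq).1 hr)).1 (by omega)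
      have hl := abs_lt.1 (hside r).abs_fract_sub_lt
      rw [Nat.cast_sub hts.le, sub_mul] at hb
      have h1 := side s hs (by omega) r hr
      have h2 := side t ht (by omega) r hr
      by_cases hσ : σ r
      · rw [nint_of_le_fract (h1.1 hσ), nint_of_le_fract (h2.1 hσ)] at hc
        have := hb.1 hσ
        rw [fract_sub_of_pos (by linarith)] at this
        exact this ⟨by linarith, by linarith⟩
      · rw [nint_of_fract_le (h1.2 hσ), nint_of_fract_le (h2.2 hσ)] at hc
        have := hb.2 hσ
        rw [fract_sub_of_neg (by linarith)] at this
        exact this (by linarith)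
    have off : ∀ p ∈ Q, ∀ r ∉ R, Int.fract (p * α r) = 0 :=
      fun p hp r hr => not_not.1 fun h => hr ((memR hp).2 h)
    have hlts : lenm α t < lenm α s := by
      refine lt_of_le_of_ne ?_ fun h => hts.ne (hinj htQ hsQ h)
      refine le_of_sq_le_sq ?_ (lenm_nonneg _ _)
      rw [lenm_sq (off s hsQ), lenm_sq (off t htQ)]
      exact Finset.sum_le_sum fun r _ => pow_le_pow_left₀ (nint_nonneg _) (hle r r.2) 2
    obtain ⟨r, hr, hhalf⟩ : ∃ r ∈ R, nint (s * α r) < 1 / 2 := by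
      by_contra! hc
      apply (hlt s hs).not_ge
      refine le_of_sq_le_sq ?_ (lenm_nonneg _ _)
      rw [lenm_sq (off s hsQ), lenm_sq (off q hq)]
      exact Finset.sum_le_sum fun r _ =>
        pow_le_pow_left₀ (nint_nonneg _) ((nint_le_half _).trans (hc r r.2)) 2
    obtain ⟨M', σ', -, hσ', hbar'⟩ := (hQ s hsQ).2.2.1.exists_barrier
    have hb := (hbar' t (hQ t htQ).1 (hQ t htQ).2.1 hlts r ((memR hsQ).1 hr)).1 (by omega)
    have ht0 := lt_of_le_of_ne (Int.fract_nonneg _) (Ne.symm ((memR htQ).1 hr))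
    have hhalf' := (hle r hr).trans_lt hhalf
    rcases hside r with h | h | h
    · exact (memR hsQ).1 hr h.1
    · rw [nint_of_fract_le h.2.2.1] at hhalf
      rw [nint_of_fract_le h.2.2.2] at hhalf'
      exact hb.1 ((hσ' r).1 h.1 hhalf) ⟨ht0, hhalf'⟩
    · rw [nint_of_le_fract h.1] at hhalf
      rw [nint_of_le_fract h.2] at hhalf'
      exact hb.2 ((hσ' r).2 (by linarith)) (by linarith)
  let code : ℕ → (β ⊕ β) ⊕ ((R → Bool) × β) := fun s =>
    if s < q then .inl (.inl (cell fun r => nint (s * α r)))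
    else if s < M + q then .inl (.inr (cell fun r => nint (s * α r)))
    else .inr (fun r => decide (Int.fract (s * α r) ≤ 1 / 2), cell fun r => nint (s * α r))
  have hcode : ∀ s ∈ Q.erase q, ∀ t ∈ Q.erase q, t < s → code s ≠ code t := by
    intro s hs t ht hts h
    have hsn := (hQ s (Finset.mem_of_mem_erase hs)).2.1
    simp only [code] at h
    split_ifs at h with h1 h2 h3 h4 h5 h6 h7 h8
    all_goals simp only [Sum.inl.injEq, Sum.inr.injEq, reduceCtorEq, Prod.mk.injEq] at h
    · exact below s hs t ht hts h1 h
    · have := far s hs t ht hts (sideAB s hs t ht ‹_› ‹_›) h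
      omega
    · have := far s hs t ht hts (sameSide s hs t ht fun r hr => ?_) h.2
      · omega
      have := congrFun h.1 ⟨r, hr⟩
      simp only [decide_eq_decide] at this
      rcases le_total (Int.fract (s * α r)) (1 / 2) with h' | h'
      · exact Or.inr ⟨h', this.1 h'⟩
      · rcases h'.eq_or_lt with h' | h'
        · exact Or.inr ⟨h'.ge, this.1 h'.ge⟩
        · exact Or.inl ⟨h'.le, (not_le.1 fun h'' => h'.not_ge (this.2 h'')).le⟩
  have hcard := Finset.card_le_card_of_injOn (s := Q.erase q) (t := Finset.univ) code
    (fun _ _ => Finset.mem_univ _) (by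
      intro s hs t ht h
      by_contra hne
      rcases lt_or_gt_of_ne hne with h' | h'
      · exact hcode t ht s hs h' h.symm
      · exact hcode s hs t ht h' h)
  rw [Finset.card_erase_of_mem hq, Finset.card_univ, Fintype.card_sum, Fintype.card_sum,
    Fintype.card_prod, Fintype.card_fun, Fintype.card_bool, Fintype.card_coe] at hcard
  have : Fintype.card β * (2 ^ R.card + 2) =
      Fintype.card β + Fintype.card β + 2 ^ R.card * Fintype.card β := by ring
  omega

/-- Cutting `[0, L)` into `N` equal pieces in each coordinate. -/
lemma exists_isCellMap_box {ι : Type*} [Fintype ι] [Nonempty ι] {N : ℕ} (hN : 0 < N)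
    (hι : Fintype.card ι ≤ N ^ 2) {L : ℝ} (hL : 0 < L) :
    ∃ cell : (ι → ℝ) → (ι → Fin N), IsCellMap L cell := by
  have hN' : (0 : ℝ) < N := Nat.cast_pos.2 hN
  have floor_lt : ∀ v : ι → ℝ, (∀ i, 0 ≤ v i) → ∑ i, v i ^ 2 < L ^ 2 → ∀ i,
      ⌊v i * N / L⌋₊ < N := by
    intro v hv h i
    have h1 : v i < L := by
      refine lt_of_pow_lt_pow_left₀ 2 hL.le (lt_of_le_of_lt ?_ h)
      exact Finset.single_le_sum (f := fun i => v i ^ 2) (fun i _ => sq_nonneg _)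
        (Finset.mem_univ i)
    rw [Nat.floor_lt (div_nonneg (mul_nonneg (hv i) hN'.le) hL.le), div_lt_iff₀ hL, mul_comm]
    exact mul_lt_mul_of_pos_left h1 hN'
  refine ⟨fun v i => ⟨⌊v i * N / L⌋₊ % N, Nat.mod_lt _ hN⟩, ?_⟩
  intro v w hv hw hvL hwL h
  have key : ∀ i, (v i - w i) ^ 2 < (L / N) ^ 2 := by
    intro i
    have hi := congrArg Fin.val (congrFun h i)
    simp only [Nat.mod_eq_of_lt (floor_lt v hv hvL i), Nat.mod_eq_of_lt (floor_lt w hw hwL i)]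
      at hi
    have v1 := Nat.floor_le (div_nonneg (mul_nonneg (hv i) hN'.le) hL.le)
    have v2 := Nat.lt_floor_add_one (v i * N / L)
    have w1 := Nat.floor_le (div_nonneg (mul_nonneg (hw i) hN'.le) hL.le)
    have w2 := Nat.lt_floor_add_one (w i * N / L)
    rw [hi] at v1 v2
    have e : v i - w i = (v i * N / L - w i * N / L) * (L / N) := by field_simp
    have hpos : 0 < L / N := div_pos hL hN'
    rw [e, mul_pow]
    have : (v i * N / L - w i * N / L) ^ 2 < 1 := by
      rw [sq_lt_one_iff_abs_lt_one, abs_lt]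
      constructor <;> linarith
    exact mul_lt_of_lt_one_left (pow_pos hpos 2) this
  calc ∑ i, (v i - w i) ^ 2 < ∑ _i : ι, (L / N) ^ 2 :=
        Finset.sum_lt_sum_of_nonempty Finset.univ_nonempty fun i _ => key i
    _ = Fintype.card ι * (L / N) ^ 2 := by simp
    _ ≤ (N : ℝ) ^ 2 * (L / N) ^ 2 := by
        apply mul_le_mul_of_nonneg_right _ (sq_nonneg _)
        exact_mod_cast hι
    _ = L ^ 2 := by field_simp

/-- In dimension at most `3`, sorting vectors by the position of their largest coordinate yields
cells whose elements make angles of at most `π / 3`. -/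
lemma exists_isCellMap_argmax {ι : Type*} [Fintype ι] [Nonempty ι] (hι : Fintype.card ι ≤ 3)
    {L : ℝ} : ∃ cell : (ι → ℝ) → ι, IsCellMap L cell := by
  classical
  choose cell hcell using fun v : ι → ℝ => Finite.exists_max v
  refine ⟨cell, fun v w hv hw hvL hwL h => ?_⟩
  have hv' := hcell v
  have hw' := hcell w
  rw [← h] at hw'
  generalize cell v = i at hv' hw'
  rcases (hv i).eq_or_lt with hi | hi
  · have : ∀ j, v j = 0 := fun j => le_antisymm (hi ▸ hv' j) (hv j)
    simpa [this] using hwL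
  rcases (hw i).eq_or_lt with hi' | hi'
  · have : ∀ j, w j = 0 := fun j => le_antisymm (hi' ▸ hw' j) (hw j)
    simpa [this] using hvL
  set a := v i
  set x := w i
  set V := ∑ j, v j ^ 2 with hV
  set W := ∑ j, w j ^ 2 with hW
  set P := ∑ j, v j * w j with hP
  have key : ∀ j, x ^ 2 * v j ^ 2 + a ^ 2 * w j ^ 2 - 4 * a * x * (v j * w j) ≤
      a ^ 2 * x ^ 2 := by
    intro j
    have h1 := hv j
    have h2 := hw j
    have h3 := hv' j
    have h4 := hw' j
    have hb : 0 ≤ (x * v j) * (a * w j) := by positivity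
    have hbx : x * v j ≤ a * x := by rw [mul_comm a]; exact mul_le_mul_of_nonneg_left h3 hi'.le
    have hyx : a * w j ≤ a * x := mul_le_mul_of_nonneg_left h4 hi.le
    have hb0 : 0 ≤ x * v j := by positivity
    have hy0 : 0 ≤ a * w j := by positivity
    have hax : 0 < a * x := by positivity
    generalize hB : x * v j = B at *
    generalize hY : a * w j = Y at *
    have e : x ^ 2 * v j ^ 2 + a ^ 2 * w j ^ 2 - 4 * a * x * (v j * w j) =
        B ^ 2 + Y ^ 2 - 4 * (B * Y) := by rw [← hB, ← hY]; ring
    rw [e, ← mul_pow]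
    generalize a * x = c at *
    rcases le_total B Y with h | h <;> nlinarith
  have hsum : x ^ 2 * V + a ^ 2 * W ≤ 4 * a * x * P := by
    have h1 : ∑ j ∈ Finset.univ.erase i,
        (x ^ 2 * v j ^ 2 + a ^ 2 * w j ^ 2 - 4 * a * x * (v j * w j)) ≤ 2 * (a ^ 2 * x ^ 2) := by
      refine (Finset.sum_le_sum fun j _ => key j).trans ?_
      rw [Finset.sum_const, nsmul_eq_mul, Finset.card_erase_of_mem (Finset.mem_univ i),
        Finset.card_univ]
      apply mul_le_mul_of_nonneg_right _ (by positivity)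
      have : Fintype.card ι - 1 ≤ 2 := by omega
      exact_mod_cast this
    have h2 : ∑ j, (x ^ 2 * v j ^ 2 + a ^ 2 * w j ^ 2 - 4 * a * x * (v j * w j)) =
        x ^ 2 * V + a ^ 2 * W - 4 * a * x * P := by
      rw [Finset.sum_sub_distrib, Finset.sum_add_distrib, hV, hW, hP, Finset.mul_sum,
        Finset.mul_sum, Finset.mul_sum]
    rw [← Finset.add_sum_erase _ _ (Finset.mem_univ i)] at h2
    have e : x ^ 2 * v i ^ 2 + a ^ 2 * w i ^ 2 - 4 * a * x * (v i * w i) =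
      -(2 * (a ^ 2 * x ^ 2)) := by simp only [a, x]; ring
    linarith
  have hd : ∑ j, (v j - w j) ^ 2 = V + W - 2 * P := by
    rw [hV, hW, hP, Finset.mul_sum, ← Finset.sum_add_distrib, ← Finset.sum_sub_distrib]
    exact Finset.sum_congr rfl fun j _ => by ring
  have hV0 : 0 ≤ V := Finset.sum_nonneg fun j _ => sq_nonneg _
  have hW0 : 0 ≤ W := Finset.sum_nonneg fun j _ => sq_nonneg _
  have hP0 : min V W ≤ 2 * P := by
    have hax : 0 < 2 * (a * x) := by positivity
    have hm0 : 0 ≤ min V W := le_min hV0 hW0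
    have h1 : (2 * (a * x)) * min V W ≤ (2 * (a * x)) * (2 * P) := by
      have h2 : x ^ 2 * min V W ≤ x ^ 2 * V :=
        mul_le_mul_of_nonneg_left (min_le_left _ _) (sq_nonneg _)
      have h3 : a ^ 2 * min V W ≤ a ^ 2 * W :=
        mul_le_mul_of_nonneg_left (min_le_right _ _) (sq_nonneg _)
      nlinarith [mul_nonneg (sq_nonneg (a - x)) hm0]
    exact le_of_mul_le_mul_left h1 hax
  rw [hd]
  rcases min_choice V W with h' | h' <;> rw [h'] at hP0 <;> linarith

/-- Distances of winners with support `R`. -/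
def winnerLengths {m : ℕ} (α : Fin m → ℝ) (n : ℕ) (R : Finset (Fin m)) : Set ℝ :=
  lenm α '' {q | 1 ≤ q ∧ q < n ∧ IsWinner α n q ∧ fractSupport α q = R}

lemma ncard_winnerLengths_le {m : ℕ} (α : Fin m → ℝ) (n : ℕ) (R : Finset (Fin m))
    {β : Type*} [Fintype β] (hβ : ∀ L > 0, ∃ cell : (R → ℝ) → β, IsCellMap L cell) :
    (winnerLengths α n R).ncard ≤ Fintype.card β * (2 ^ R.card + 2) + 1 := by
  obtain ⟨Q, hQs, hQi, hinj⟩ := Set.SurjOn.exists_subset_injOn_image_eq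
    (Set.surjOn_image (lenm α) {q | 1 ≤ q ∧ q < n ∧ IsWinner α n q ∧ fractSupport α q = R})
  have hfin : Q.Finite := (Set.finite_Iio n).subset fun q hq => (hQs hq).2.1
  lift Q to Finset ℕ using hfin
  unfold winnerLengths
  rw [← hinj, hQi.ncard_image, Set.ncard_coe_finset]
  exact card_winners_le hβ Q (fun q hq => hQs hq) hQi

lemma ncard_winnerLengths_empty_le {m : ℕ} (α : Fin m → ℝ) (n : ℕ) :
    (winnerLengths α n ∅).ncard ≤ 1 := by
  refine (Set.ncard_le_ncard (t := {0}) ?_).trans (Set.ncard_singleton _).le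
  rintro _ ⟨q, ⟨-, -, -, hq⟩, rfl⟩
  have h := lenm_sq (α := α) (q := q) (R := ∅) (by
    intro r _
    by_contra h
    rw [← ne_eq, ← mem_fractSupport, hq] at h
    exact absurd h (Finset.notMem_empty _))
  simpa using h

lemma ncard_winnerLengths_le_box {m : ℕ} (α : Fin m → ℝ) (n : ℕ) (R : Finset (Fin m)) {N : ℕ}
    (hN : 0 < N) (hm : m ≤ N ^ 2) :
    (winnerLengths α n R).ncard ≤ N ^ R.card * (2 ^ R.card + 2) + 1 := by
  rcases R.eq_empty_or_nonempty with rfl | hR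
  · exact (ncard_winnerLengths_empty_le α n).trans (Nat.le_add_left _ _)
  · have : Nonempty R := hR.to_subtype
    have hc : Fintype.card R ≤ N ^ 2 := by
      rw [Fintype.card_coe]
      exact (R.card_le_univ.trans_eq (Fintype.card_fin m)).trans hm
    have := ncard_winnerLengths_le α n R fun L hL => exists_isCellMap_box hN hc hL
    simpa using this

lemma ncard_winnerLengths_le_argmax {m : ℕ} (α : Fin m → ℝ) (n : ℕ) (R : Finset (Fin m))
    (hR3 : R.card ≤ 3) :
    (winnerLengths α n R).ncard ≤ R.card * (2 ^ R.card + 2) + 1 := by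
  rcases R.eq_empty_or_nonempty with rfl | hR
  · exact (ncard_winnerLengths_empty_le α n).trans (Nat.le_add_left _ _)
  · have : Nonempty R := hR.to_subtype
    have hc : Fintype.card R ≤ 3 := by rwa [Fintype.card_coe]
    have := ncard_winnerLengths_le α n R fun L _ => exists_isCellMap_argmax hc
    simpa using this

lemma pow_seven_add_le {m : ℕ} (hm : 3 ≤ m) : 7 ^ m + 2 * 4 ^ m + 2 ^ m ≤ 9 ^ m := by
  induction m, hm using Nat.le_induction with
  | base => norm_num
  | succ m _ ih =>
    rw [pow_succ, pow_succ, pow_succ, pow_succ]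
    omega

lemma pow_add_pow_le_pow_sq {m N : ℕ} (hm : 3 ≤ m) (hN : 3 ≤ N) :
    (2 * N + 1) ^ m + 2 * (N + 1) ^ m + 2 ^ m ≤ (N ^ 2) ^ m := by
  have h3 : 0 < 3 ^ m := by positivity
  refine le_of_mul_le_mul_left ?_ h3
  calc 3 ^ m * ((2 * N + 1) ^ m + 2 * (N + 1) ^ m + 2 ^ m)
      = (3 * (2 * N + 1)) ^ m + 2 * (3 * (N + 1)) ^ m + (3 * 2) ^ m := by
        rw [mul_pow, mul_pow, mul_pow]; ring
    _ ≤ (7 * N) ^ m + 2 * (4 * N) ^ m + (2 * N) ^ m :=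
        add_le_add (add_le_add (Nat.pow_le_pow_left (by omega) m)
          (Nat.mul_le_mul_left 2 (Nat.pow_le_pow_left (by omega) m)))
          (Nat.pow_le_pow_left (by omega) m)
    _ = (7 ^ m + 2 * 4 ^ m + 2 ^ m) * N ^ m := by rw [mul_pow, mul_pow, mul_pow]; ring
    _ ≤ 9 ^ m * N ^ m := Nat.mul_le_mul_right _ (pow_seven_add_le hm)
    _ = (3 * (3 * N)) ^ m := by rw [← mul_assoc, mul_pow]; norm_num
    _ ≤ (3 * (N * N)) ^ m := by gcongr
    _ = 3 ^ m * (N ^ 2) ^ m := by rw [mul_pow, sq]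

lemma sum_box_bound {m : ℕ} (N : ℕ) :
    ∑ R : Finset (Fin m), (N ^ R.card * (2 ^ R.card + 2) + 1) =
      (2 * N + 1) ^ m + 2 * (N + 1) ^ m + 2 ^ m := by
  have h : ∀ a : ℕ, ∑ R : Finset (Fin m), a ^ R.card = (a + 1) ^ m := by
    intro a
    simpa using Fin.sum_pow_mul_eq_add_pow (n := m) a 1
  rw [← h, ← h, Finset.mul_sum, ← Finset.sum_add_distrib]
  have h1 : 2 ^ m = ∑ R : Finset (Fin m), 1 := by simp
  rw [h1, ← Finset.sum_add_distrib]
  refine Finset.sum_congr rfl fun R _ => ?_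
  rw [mul_pow]; ring

lemma sum_ncard_winnerLengths_le {m : ℕ} (hm : 1 ≤ m) (α : Fin m → ℝ) (n : ℕ) {N : ℕ}
    (hN : 0 < N) (hmN : m ≤ N ^ 2) :
    ∑ R : Finset (Fin m), (winnerLengths α n R).ncard ≤ N ^ m * (N ^ m + 2 ^ m + 1) + 2 := by
  rcases le_or_gt 5 m with h5 | h5
  · have h3 : 3 ≤ N := by nlinarith
    calc ∑ R : Finset (Fin m), (winnerLengths α n R).ncard
        ≤ ∑ R : Finset (Fin m), (N ^ R.card * (2 ^ R.card + 2) + 1) :=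
          Finset.sum_le_sum fun R _ => ncard_winnerLengths_le_box α n R hN hmN
      _ = (2 * N + 1) ^ m + 2 * (N + 1) ^ m + 2 ^ m := sum_box_bound N
      _ ≤ (N ^ 2) ^ m := pow_add_pow_le_pow_sq (by omega) h3
      _ = N ^ m * N ^ m := by rw [sq, mul_pow]
      _ ≤ N ^ m * (N ^ m + 2 ^ m + 1) + 2 :=
          (Nat.mul_le_mul_left _ (by rw [add_assoc]; exact Nat.le_add_right _ _)).trans
            (Nat.le_add_right _ _)
  · have hle : ∀ R : Finset (Fin m), (winnerLengths α n R).ncard ≤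
        (if R.card ≤ 3 then R.card else N ^ 4) * (2 ^ R.card + 2) + 1 := by
      intro R
      have hR : R.card ≤ m := R.card_le_univ.trans_eq (Fintype.card_fin m)
      split_ifs with h
      · exact ncard_winnerLengths_le_argmax α n R h
      · have h4 : R.card = 4 := by omega
        simpa [h4] using ncard_winnerLengths_le_box α n R hN hmN
    refine (Finset.sum_le_sum fun R _ => hle R).trans ?_
    rw [← Finset.powerset_univ, Finset.sum_powerset_apply_card
      (fun k => (if k ≤ 3 then k else N ^ 4) * (2 ^ k + 2) + 1), Finset.card_univ,
      Fintype.card_fin]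
    interval_cases m
    · simp [Finset.sum_range_succ]
      nlinarith
    · have h2 : 2 ≤ N := by nlinarith
      have : 2 ^ 2 ≤ N ^ 2 := Nat.pow_le_pow_left h2 2
      simp [Finset.sum_range_succ, Nat.choose]
      nlinarith
    · have h2 : 2 ≤ N := by nlinarith
      have : 2 ^ 3 ≤ N ^ 3 := Nat.pow_le_pow_left h2 3
      simp [Finset.sum_range_succ, Nat.choose]
      nlinarith
    · have h2 : 2 ≤ N := by nlinarith
      have : 2 ^ 4 ≤ N ^ 4 := Nat.pow_le_pow_left h2 4
      simp [Finset.sum_range_succ, Nat.choose]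
      nlinarith

/-- The paper's higher-dimensional theorem: the set of Euclidean distances
`d(j,k) = √(Σᵢ ‖(k−j)αᵢ‖²)` of pairs `1 ≤ j < k ≤ n` which are not defeated by any strictly
shorter pair overlapping in one of the `m` coordinate projections has at most
`⌈√m⌉^m (⌈√m⌉^m + 2^m + 1) + 2` elements. -/
theorem higher_dimensional_distances (m : ℕ) (hm : 1 ≤ m) (α : Fin m → ℝ)
    (n : ℕ) (hn : 1 ≤ n) :
    Set.ncard { d : ℝ | ∃ j k : ℕ, 1 ≤ j ∧ j < k ∧ k ≤ n ∧
        d = lenm α (k - j) ∧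
        ∀ p q : ℕ, 1 ≤ p → p < q → q ≤ n →
          lenm α (q - p) < lenm α (k - j) →
            ∀ r : Fin m,
              geodesic (Int.fract ((p : ℝ) * α r)) (Int.fract ((q : ℝ) * α r)) ∩
                geodesic (Int.fract ((j : ℝ) * α r)) (Int.fract ((k : ℝ) * α r)) = ∅ }
      ≤ ⌈Real.sqrt m⌉₊ ^ m * (⌈Real.sqrt m⌉₊ ^ m + 2 ^ m + 1) + 2 := by
  have hN : 0 < ⌈Real.sqrt m⌉₊ := Nat.ceil_pos.2 (Real.sqrt_pos.2 (by exact_mod_cast hm))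
  have hmN : m ≤ ⌈Real.sqrt m⌉₊ ^ 2 := by
    have h := pow_le_pow_left₀ (Real.sqrt_nonneg m) (Nat.le_ceil (Real.sqrt m)) 2
    rw [Real.sq_sqrt (Nat.cast_nonneg m)] at h
    exact_mod_cast h
  refine le_trans ?_ (sum_ncard_winnerLengths_le hm α n hN hmN)
  refine le_trans (Set.ncard_le_ncard ?_ ?_)
    (Finset.set_ncard_biUnion_le Finset.univ (winnerLengths α n))
  · rintro _ ⟨j, k, hj, hjk, hk, rfl, hw⟩
    refine Set.mem_biUnion (Finset.mem_univ (fractSupport α (k - j))) ?_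
    exact ⟨k - j, ⟨by omega, by omega, ⟨j, k, hj, hjk, hk, rfl, hw⟩, rfl⟩, rfl⟩
  · refine Set.Finite.biUnion (Set.toFinite _) fun R _ => Set.Finite.image _ ?_
    exact (Set.finite_Iio n).subset fun q hq => hq.2.1
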